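/- arXiv:0904.1002 — 2 statements merged into one kernel-verified Lean document; each statement's English description precedes it below -/
import Mathlib

section
/- optcost(n+1) - optcost(n) is nondecreasing in n; that is, the marginal cost of adding a job to the optimal offline schedule is a nondecreasing function of the number of jobs. -/
/-- Cost of a list of batch sizes, where `i` batches have already been scheduled
and `t` jobs already processed: batch `b` completes at time `i + 1 + t + b`. -/
def batchCostAux : ℕ → ℕ → List ℕ → ℕ
  | _, _, [] => 0
  | i, t, b :: rest => b * (i + 1 + t + b) + batchCostAux (i + 1) (t + b) rest

/-- Total cost of a composition `l = (b_1, ..., b_r)`:  `Σ_i b_i (i + Σ_{j ≤ i} b_j)`. -/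
def batchCost (l : List ℕ) : ℕ := batchCostAux 0 0 l

/-- Minimum sum of completion times for `n` unit jobs in the list 1-batch problem. -/
noncomputable def optcost (n : ℕ) : ℕ :=
  sInf {c | ∃ l : List ℕ, (∀ b ∈ l, 0 < b) ∧ l.sum = n ∧ batchCost l = c}

/-- Six times the `k`-th supporting quadratic of `optcost`. -/
def suppG (k n : ℕ) : ℤ :=
  3 * n * (n - 1) + 12 * n + 6 * k * n - k * (k + 1) * (k + 2)

lemma batchCostAux_shift (l : List ℕ) : ∀ i t : ℕ,
    batchCostAux i t l = (i + t) * l.sum + batchCostAux 0 0 l := by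
  induction l with
  | nil => intro i t; simp [batchCostAux]
  | cons b r ih =>
    intro i t
    simp only [batchCostAux, List.sum_cons]
    rw [ih (i + 1) (t + b), ih (0 + 1) (0 + b)]
    ring

lemma batchCost_cons (b : ℕ) (r : List ℕ) :
    batchCost (b :: r) = (1 + b) * (b + r.sum) + batchCost r := by
  unfold batchCost
  simp only [batchCostAux]
  rw [batchCostAux_shift r (0 + 1) (0 + b)]
  ring

lemma int_sq_self_nonneg (x : ℤ) : 0 ≤ x * (x + 1) := by
  rcases le_or_gt 0 x with h | h
  · positivity
  · nlinarith

lemma suppG_le (l : List ℕ) : ∀ k : ℕ, suppG k l.sum ≤ 6 * (batchCost l : ℤ) := by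
  induction l with
  | nil =>
    intro k
    simp only [suppG, List.sum_nil, batchCost, batchCostAux]
    push_cast
    have : (0 : ℤ) ≤ k * (k + 1) * (k + 2) := by positivity
    linarith
  | cons b r ih =>
    intro k
    rw [batchCost_cons, List.sum_cons]
    cases k with
    | zero =>
      have h := ih 0
      have h2 := int_sq_self_nonneg ((b : ℤ) - 1)
      have h3 : (0 : ℤ) ≤ (r.sum : ℤ) := by positivity
      simp only [suppG] at *
      push_cast at *
      nlinarith
    | succ k =>
      have h := ih k
      have h2 := int_sq_self_nonneg ((k : ℤ) + 1 - b)
      simp only [suppG] at *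
      push_cast at *
      nlinarith

lemma suppG_attained (m : ℕ) : ∀ n : ℕ, m * (m + 1) ≤ 2 * n → 2 * n ≤ (m + 1) * (m + 2) →
    ∃ l : List ℕ, (∀ b ∈ l, 0 < b) ∧ l.sum = n ∧ 6 * (batchCost l : ℤ) = suppG m n := by
  induction m with
  | zero =>
    intro n _ h
    have : n = 0 ∨ n = 1 := by omega
    rcases this with rfl | rfl
    · exact ⟨[], by simp, by simp, by simp [batchCost, batchCostAux, suppG]⟩
    · exact ⟨[1], by simp, by simp, by simp [batchCost, batchCostAux, suppG]⟩
  | succ m ih =>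
    intro n h1 h2
    rcases Nat.eq_or_lt_of_le h2 with h | h
    · obtain ⟨a, rfl⟩ : ∃ a, n = (m + 2) + a := ⟨n - (m + 2), by
        have : m + 2 ≤ n := by nlinarith
        omega⟩
      obtain ⟨l, hp, hs, hc⟩ := ih a (by nlinarith) (by nlinarith)
      refine ⟨(m + 2) :: l, ?_, by simp [hs], ?_⟩
      · intro b hb
        rcases List.mem_cons.1 hb with rfl | hb
        · omega
        · exact hp b hb
      · rw [batchCost_cons, hs]
        push_cast
        rw [mul_add, hc]
        simp only [suppG]
        push_cast
        ring
    · obtain ⟨a, rfl⟩ : ∃ a, n = (m + 1) + a := ⟨n - (m + 1), by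
        have : m + 1 ≤ n := by nlinarith
        omega⟩
      have hev : 2 * a ≤ (m + 1) * (m + 2) := by
        obtain ⟨c, hc⟩ := Nat.even_mul_succ_self (m + 1)
        have e : (m + 1 + 1) * (m + 1 + 2) = (m + 1) * (m + 1 + 1) + 2 * (m + 2) := by ring
        have e2 : (m + 1) * (m + 2) = (m + 1) * (m + 1 + 1) := by ring
        omega
      obtain ⟨l, hp, hs, hc⟩ := ih a (by nlinarith) hev
      refine ⟨(m + 1) :: l, ?_, by simp [hs], ?_⟩
      · intro b hb
        rcases List.mem_cons.1 hb with rfl | hb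
        · omega
        · exact hp b hb
      · rw [batchCost_cons, hs]
        push_cast
        rw [mul_add, hc]
        simp only [suppG]
        push_cast
        ring

lemma exists_triangular (n : ℕ) : ∃ m : ℕ, m * (m + 1) ≤ 2 * n ∧ 2 * n ≤ (m + 1) * (m + 2) := by
  induction n with
  | zero => exact ⟨0, by simp, by simp⟩
  | succ n ih =>
    obtain ⟨m, h1, h2⟩ := ih
    by_cases h : 2 * (n + 1) ≤ (m + 1) * (m + 2)
    · exact ⟨m, by omega, h⟩
    · exact ⟨m + 1, by nlinarith, by nlinarith⟩

lemma suppG_le_optcost (k n : ℕ) : suppG k n ≤ 6 * (optcost n : ℤ) := by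
  have hne : {c | ∃ l : List ℕ, (∀ b ∈ l, 0 < b) ∧ l.sum = n ∧ batchCost l = c}.Nonempty := by
    obtain ⟨m, h1, h2⟩ := exists_triangular n
    obtain ⟨l, hp, hs, _⟩ := suppG_attained m n h1 h2
    exact ⟨_, l, hp, hs, rfl⟩
  obtain ⟨l, _, hs, hc⟩ := Nat.sInf_mem hne
  have h := suppG_le l k
  rw [hs, hc] at h
  exact h

lemma exists_optcost_le (n : ℕ) : ∃ m, 6 * (optcost n : ℤ) ≤ suppG m n := by
  obtain ⟨m, h1, h2⟩ := exists_triangular n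
  obtain ⟨l, hp, hs, hc⟩ := suppG_attained m n h1 h2
  have : optcost n ≤ batchCost l := Nat.sInf_le ⟨l, hp, hs, rfl⟩
  exact ⟨m, by omega⟩

/-- The marginal cost `optcost (n+1) - optcost n` is nondecreasing in `n`. -/
theorem optcost_increments_monotone (n : ℕ) :
    optcost (n + 1) - optcost n ≤ optcost (n + 2) - optcost (n + 1) := by
  obtain ⟨m, hm⟩ := exists_optcost_le (n + 1)
  have h0 := suppG_le_optcost m n
  have h2 := suppG_le_optcost m (n + 2)
  have key : 2 * suppG m (n + 1) ≤ suppG m n + suppG m (n + 2) := by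
    simp only [suppG]
    push_cast
    nlinarith
  omega
end

section
/- For the list 1-batch problem with unit jobs, no online algorithm has competitive ratio strictly less than 619/583 even on instances of at most 100 jobs: for every infinite binary decision sequence (specifying for each arriving job whether to start a new batch), there exists some n ≤ 100 such that the online cost on the first n jobs is at least (619/583)·optcost(n). -/
/-- State after the first `j` jobs for the online algorithm given by decisions `d`
(`d j = true` means job `j ≥ 2` starts a new batch): `(current batch index,
position of the most recent batch boundary, cost of all closed batches)`. -/
def ocSt (d : ℕ → Bool) : ℕ → ℕ × ℕ × ℕ
  | 0 => (1, 0, 0)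
  | j + 1 =>
    let (r, s, a) := ocSt d j
    if j ≠ 0 ∧ d (j + 1) = true then (r + 1, j, a + (j - s) * (r + j)) else (r, s, a)

/-- Online cost of the first `n` jobs: cost of closed batches plus the cost of
the final (possibly open) batch, which completes at time `r + n`. -/
def onlineCost (d : ℕ → Bool) (n : ℕ) : ℕ :=
  let (r, s, a) := ocSt d n
  a + (n - s) * (r + n)

/-- Batch sizes `m, m-1, ..., 1`, with the size `k` (if `1 ≤ k ≤ m`) used twice. -/
def desc : ℕ → ℕ → List ℕ
  | 0, _ => []
  | m + 1, k => if m + 1 = k then (m + 1) :: (m + 1) :: desc m k else (m + 1) :: desc m k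

/-- `n = m (m + 1) / 2 + k` with `k ≤ m`. -/
def triRep : ℕ → ℕ × ℕ
  | 0 => (0, 0)
  | n + 1 => if (triRep n).2 = (triRep n).1 then ((triRep n).1 + 1, 0)
      else ((triRep n).1, (triRep n).2 + 1)

/-- A good offline schedule for `n` jobs. -/
def sched (n : ℕ) : List ℕ := desc (triRep n).1 (triRep n).2

theorem optcost_le (n : ℕ) (l : List ℕ) (h : ∀ b ∈ l, 0 < b) (hs : l.sum = n) :
    optcost n ≤ batchCost l := Nat.sInf_le ⟨l, h, hs, rfl⟩

theorem sched_ok : ∀ n < 101, (∀ b ∈ sched n, 0 < b) ∧ (sched n).sum = n := by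
  decide +kernel

/-- `k n`, written so that the kernel evaluates `n` before substituting it. -/
def force {α : Type} (n : ℕ) (k : ℕ → α) : α :=
  Nat.rec (k 0) (fun m _ => k (Nat.succ m)) n

theorem force_eq {α : Type} (n : ℕ) (k : ℕ → α) : force n k = k n := by
  cases n <;> rfl

/-- `k l`, written so that the kernel evaluates `l` before substituting it. -/
def forceL {α β : Type} (l : List α) (k : List α → β) : β :=
  List.rec (k []) (fun x t _ => k (x :: t)) l

theorem forceL_eq {α β : Type} (l : List α) (k : List α → β) : forceL l k = k l := by
  cases l <;> rfl

/-- Boolean membership test for a state. -/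
def memB (r s a : ℕ) : List (ℕ × ℕ × ℕ) → Bool
  | [] => false
  | x :: l => cond (Nat.beq a x.2.2)
      (cond (Nat.beq r x.1) (cond (Nat.beq s x.2.1) true (memB r s a l)) (memB r s a l))
      (memB r s a l)

theorem mem_of_memB {r s a : ℕ} {l : List (ℕ × ℕ × ℕ)} (h : memB r s a l = true) :
    (r, s, a) ∈ l := by
  induction l with
  | nil => simp [memB] at h
  | cons x l ih =>
    obtain ⟨x1, x2, x3⟩ := x
    simp only [memB, Bool.cond_eq_ite, Nat.beq_eq] at h
    split_ifs at h with h1 h2 h3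
    · simp [h1, h2, h3]
    all_goals exact List.mem_cons_of_mem _ (ih h)

/-- The states whose cost at `n` is still below the bound (`c` is `619` times the offline cost),
put in front of `acc`. -/
def kept (n c : ℕ) : List (ℕ × ℕ × ℕ) → List (ℕ × ℕ × ℕ) → List (ℕ × ℕ × ℕ)
  | [], acc => acc
  | x :: l, acc => cond (Nat.ble c (583 * (x.2.2 + (n - x.2.1) * (x.1 + n))))
      (kept n c l acc) (kept n c l (x :: acc))

/-- The states obtained by starting a new batch with job `j + 1`, put in front of `acc`;
those at or above the bound and duplicates are dropped. -/
def news (j c : ℕ) : List (ℕ × ℕ × ℕ) → List (ℕ × ℕ × ℕ) → List (ℕ × ℕ × ℕ)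
  | [], acc => acc
  | x :: l, acc =>
      force (x.1 + 1) fun r => force (x.2.2 + (j - x.2.1) * (x.1 + j)) fun a =>
        cond (Nat.ble c (583 * (a + (j + 1 - j) * (r + (j + 1))))) (news j c l acc)
          (cond (memB r j a acc) (news j c l acc) (news j c l ((r, j, a) :: acc)))

/-- States reachable after job `j + 1` from those after job `j`. -/
def stepL (j c : ℕ) (l : List (ℕ × ℕ × ℕ)) : List (ℕ × ℕ × ℕ) :=
  cond (Nat.beq j 0) (kept (j + 1) c l [])
    (forceL (news j c l []) fun acc => kept (j + 1) c l acc)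

/-- All states of surviving algorithms after `n` jobs. -/
def reach : ℕ → List (ℕ × ℕ × ℕ)
  | 0 => [(1, 0, 0)]
  | j + 1 => force (619 * batchCost (sched (j + 1))) fun c =>
      forceL (reach j) fun l => stepL j c l

theorem mem_kept_of_mem {n c : ℕ} {x : ℕ × ℕ × ℕ} (l acc : List (ℕ × ℕ × ℕ)) (hx : x ∈ acc) :
    x ∈ kept n c l acc := by
  induction l generalizing acc with
  | nil => exact hx
  | cons y l ih =>
    simp only [kept, Bool.cond_eq_ite]
    split_ifs
    · exact ih _ hx
    · exact ih _ (List.mem_cons_of_mem _ hx)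

theorem mem_kept {n c : ℕ} {x : ℕ × ℕ × ℕ} {l : List (ℕ × ℕ × ℕ)} (acc : List (ℕ × ℕ × ℕ))
    (hx : x ∈ l) (h : 583 * (x.2.2 + (n - x.2.1) * (x.1 + n)) < c) : x ∈ kept n c l acc := by
  induction l generalizing acc with
  | nil => simp at hx
  | cons y l ih =>
    simp only [kept, Bool.cond_eq_ite, Nat.ble_eq]
    rcases List.mem_cons.1 hx with rfl | hx
    · rw [if_neg (by omega)]
      exact mem_kept_of_mem _ _ (by simp)
    · split_ifs <;> exact ih _ hx

theorem mem_news_of_mem {j c : ℕ} {x : ℕ × ℕ × ℕ} (l acc : List (ℕ × ℕ × ℕ)) (hx : x ∈ acc) :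
    x ∈ news j c l acc := by
  induction l generalizing acc with
  | nil => exact hx
  | cons y l ih =>
    simp only [news, force_eq, Bool.cond_eq_ite]
    split_ifs
    · exact ih _ hx
    · exact ih _ hx
    · exact ih _ (List.mem_cons_of_mem _ hx)

theorem mem_news {j c r s a : ℕ} {l : List (ℕ × ℕ × ℕ)} (acc : List (ℕ × ℕ × ℕ))
    (hx : (r, s, a) ∈ l)
    (h : 583 * (a + (j - s) * (r + j) + (j + 1 - j) * (r + 1 + (j + 1))) < c) :
    (r + 1, j, a + (j - s) * (r + j)) ∈ news j c l acc := by
  induction l generalizing acc with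
  | nil => simp at hx
  | cons y l ih =>
    simp only [news, force_eq, Bool.cond_eq_ite, Nat.ble_eq]
    rcases List.mem_cons.1 hx with rfl | hx
    · rw [if_neg (not_le.2 h)]
      split_ifs with h1
      · exact mem_news_of_mem _ _ (mem_of_memB h1)
      · exact mem_news_of_mem _ _ (by simp)
    · split_ifs <;> exact ih _ hx

theorem mem_stepL_keep {j c : ℕ} {x : ℕ × ℕ × ℕ} {l : List (ℕ × ℕ × ℕ)} (hx : x ∈ l)
    (h : 583 * (x.2.2 + (j + 1 - x.2.1) * (x.1 + (j + 1))) < c) : x ∈ stepL j c l := by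
  unfold stepL
  simp only [Bool.cond_eq_ite, forceL_eq]
  split_ifs <;> exact mem_kept _ hx h

theorem mem_stepL_new {j c r s a : ℕ} {l : List (ℕ × ℕ × ℕ)} (hx : (r, s, a) ∈ l) (hj : j ≠ 0)
    (h : 583 * (a + (j - s) * (r + j) + (j + 1 - j) * (r + 1 + (j + 1))) < c) :
    (r + 1, j, a + (j - s) * (r + j)) ∈ stepL j c l := by
  unfold stepL
  simp only [Bool.cond_eq_ite, Nat.beq_eq, forceL_eq]
  rw [if_neg hj]
  exact mem_kept_of_mem _ _ (mem_news _ hx h)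

theorem mem_reach (d : ℕ → Bool) (N : ℕ)
    (H : ∀ n, 1 ≤ n → n ≤ N → 583 * onlineCost d n < 619 * batchCost (sched n)) :
    ocSt d N ∈ reach N := by
  induction N with
  | zero => simp [ocSt, reach]
  | succ j ih =>
    have h1 := ih fun n hn hn' => H n hn (by omega)
    have h2 := H (j + 1) (by omega) le_rfl
    rcases hst : ocSt d j with ⟨r, s, a⟩
    rw [hst] at h1
    unfold onlineCost at h2
    simp only [ocSt, hst] at h2 ⊢
    simp only [reach, force_eq, forceL_eq]
    split_ifs at h2 ⊢ with hc
    · exact mem_stepL_new h1 hc.1 h2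
    · exact mem_stepL_keep h1 h2

theorem reach_100 : reach 100 = [] := by decide +kernel

/-- Lower bound: for every online algorithm (infinite binary decision sequence),
there is some prefix length `n ≤ 100` on which the online cost is at least
`(619/583) · optcost n`. -/
theorem lower_bound_within_100 (d : ℕ → Bool) :
    ∃ n : ℕ, 1 ≤ n ∧ n ≤ 100 ∧ 619 * optcost n ≤ 583 * onlineCost d n := by
  by_contra! hcon
  have := mem_reach d 100 fun n h1 h2 => by
    have h3 := sched_ok n (by omega)
    have h4 := optcost_le n _ h3.1 h3.2
    have h5 := hcon n h1 h2
    omega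
  rw [reach_100] at this
  simp at this
end
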